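/- For every integer d ≥ 3 there is a constant c_d > 0 such that the following holds. For every ε ∈ (0,1) and every finite set P ⊆ ℝ^d of n ≥ 2 points whose weighted unit-distance graph G is connected, there exists a (1/ε)-WSPD of P with respect to the shortest-path metric d_G whose size is at most c_d·n^{2−2/d}/ε². -/

import Mathlib

open Metric Set

/-- A path in the weighted unit-distance graph of `P`: a finite sequence of points
of `P` in which consecutive points are at distance at most `1`. -/
def IsUDPath {α : Type*} [MetricSpace α] (P : Set α) (m : ℕ) (f : Fin (m + 1) → α) : Prop :=
  (∀ i, f i ∈ P) ∧ ∀ i : Fin m, dist (f i.castSucc) (f i.succ) ≤ 1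

/-- The length of a path: the sum of the lengths of its edges. -/
noncomputable def udLen {α : Type*} [MetricSpace α] (m : ℕ) (f : Fin (m + 1) → α) : ℝ :=
  ∑ i : Fin m, dist (f i.castSucc) (f i.succ)

/-- The weighted unit-distance graph of `P` is connected. -/
def UDConnected {α : Type*} [MetricSpace α] (P : Set α) : Prop :=
  ∀ x ∈ P, ∀ y ∈ P, ∃ m, ∃ f : Fin (m + 1) → α,
    IsUDPath P m f ∧ f 0 = x ∧ f (Fin.last m) = y

/-- The shortest-path metric of the weighted unit-distance graph of `P`. -/
noncomputable def dG {α : Type*} [MetricSpace α] (P : Set α) (x y : α) : ℝ :=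
  sInf {t | ∃ m, ∃ f : Fin (m + 1) → α,
    IsUDPath P m f ∧ f 0 = x ∧ f (Fin.last m) = y ∧ udLen m f = t}

/-- Diameter of a set with respect to the shortest-path metric `d_G`. -/
noncomputable def dGDiam {α : Type*} [MetricSpace α] (P : Set α) (A : Set α) : ℝ :=
  sSup {t | ∃ a ∈ A, ∃ b ∈ A, t = dG P a b}

/-- Distance between two sets with respect to the shortest-path metric `d_G`. -/
noncomputable def dGSetDist {α : Type*} [MetricSpace α] (P : Set α) (A B : Set α) : ℝ :=
  sInf {t | ∃ a ∈ A, ∃ b ∈ B, t = dG P a b}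

/-- The pair `{A, B}` is `s`-separated with respect to `d_G`. -/
def WellSepG {α : Type*} [MetricSpace α] (P : Set α) (s : ℝ) (A B : Set α) : Prop :=
  max (dGDiam P A) (dGDiam P B) ≤ (1 / s) * dGSetDist P A B

/-- `W` is an `s`-WSPD of `P` with respect to the shortest-path metric `d_G`. -/
def IsWSPDG {α : Type*} [MetricSpace α] (P : Set α) (s : ℝ)
    (W : Finset (Set α × Set α)) : Prop :=
  (∀ pr ∈ W, pr.1 ⊆ P ∧ pr.2 ⊆ P ∧ pr.1.Nonempty ∧ pr.2.Nonempty ∧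
      Disjoint pr.1 pr.2 ∧ WellSepG P s pr.1 pr.2) ∧
  ∀ x ∈ P, ∀ y ∈ P, x ≠ y →
    ∃ pr ∈ W, (x ∈ pr.1 ∧ y ∈ pr.2) ∨ (x ∈ pr.2 ∧ y ∈ pr.1)

/-- Inductive version of paths. -/
inductive UDWalk {α : Type*} [MetricSpace α] (P : Set α) : α → α → ℝ → Prop
  | nil (x : α) (hx : x ∈ P) : UDWalk P x x 0
  | cons (x y z : α) (t : ℝ) (hx : x ∈ P) (h : dist x y ≤ 1) (w : UDWalk P y z t) :
      UDWalk P x z (dist x y + t)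

section walks
variable {α : Type*} [MetricSpace α] {P : Set α}

lemma udwalk_of_path (m : ℕ) : ∀ (f : Fin (m + 1) → α), IsUDPath P m f →
    UDWalk P (f 0) (f (Fin.last m)) (udLen m f) := by
  induction m with
  | zero =>
    intro f hf
    simp only [udLen, Finset.univ_eq_empty, Finset.sum_empty]
    exact UDWalk.nil _ (hf.1 0)
  | succ m ih =>
    intro f hf
    have h1 := ih (fun i => f i.succ) ⟨fun i => hf.1 _, fun i => by
      have := hf.2 i.succ
      simpa using this⟩
    have h2 := UDWalk.cons (f 0) (f (Fin.succ 0)) _ _ (hf.1 0) (by simpa using hf.2 0) h1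
    have h3 : udLen (m + 1) f = dist (f 0) (f (Fin.succ 0)) + udLen m (fun i => f i.succ) := by
      unfold udLen
      rw [Fin.sum_univ_succ]
      simp
    rw [h3]
    exact h2

lemma path_of_udwalk {x y : α} {t : ℝ} (w : UDWalk P x y t) :
    ∃ m, ∃ f : Fin (m + 1) → α,
      IsUDPath P m f ∧ f 0 = x ∧ f (Fin.last m) = y ∧ udLen m f = t := by
  induction w with
  | nil x hx =>
    exact ⟨0, fun _ => x, ⟨fun _ => hx, fun i => i.elim0⟩, rfl, rfl, by simp [udLen]⟩
  | cons x y z t hx h w ih =>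
    obtain ⟨m, f, hf, h0, hl, ht⟩ := ih
    refine ⟨m + 1, Fin.cons x f, ⟨?_, ?_⟩, by simp, ?_, ?_⟩
    · intro i
      refine Fin.cases ?_ ?_ i
      · simpa using hx
      · intro i; simpa using hf.1 i
    · intro i
      refine Fin.cases ?_ ?_ i
      · simpa [h0] using h
      · intro i; simpa [← Fin.succ_castSucc] using hf.2 i
    · rw [← Fin.succ_last]; simpa using hl
    · unfold udLen
      rw [Fin.sum_univ_succ]
      simp only [← Fin.succ_castSucc, Fin.cons_succ, Fin.castSucc_zero, Fin.cons_zero, h0]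
      rw [← ht]; rfl

lemma dG_eq (x y : α) : dG P x y = sInf {t | UDWalk P x y t} := by
  unfold dG
  congr 1
  ext t
  constructor
  · rintro ⟨m, f, hf, h0, hl, ht⟩
    have := udwalk_of_path m f hf
    rw [h0, hl, ht] at this
    exact this
  · exact path_of_udwalk

lemma UDWalk.dist_le {x y : α} {t : ℝ} (w : UDWalk P x y t) : dist x y ≤ t := by
  induction w with
  | nil => simp
  | cons x y z t hx h w ih => linarith [dist_triangle x y z]

lemma UDWalk.left_mem {x y : α} {t : ℝ} (w : UDWalk P x y t) : x ∈ P := by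
  cases w <;> assumption

lemma UDWalk.right_mem {x y : α} {t : ℝ} (w : UDWalk P x y t) : y ∈ P := by
  induction w <;> assumption

lemma UDWalk.trans {x y z : α} {s t : ℝ} (w : UDWalk P x y s) (w' : UDWalk P y z t) :
    UDWalk P x z (s + t) := by
  induction w with
  | nil => simpa using w'
  | cons x y z t hx h w ih => rw [add_assoc]; exact UDWalk.cons _ _ _ _ hx h (ih w')

lemma UDWalk.edge {x y : α} (hx : x ∈ P) (hy : y ∈ P) (h : dist x y ≤ 1) :
    UDWalk P x y (dist x y) := by
  simpa using UDWalk.cons x y y 0 hx h (UDWalk.nil y hy)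

lemma UDWalk.symm {x y : α} {s : ℝ} (w : UDWalk P x y s) : UDWalk P y x s := by
  induction w with
  | nil x hx => exact UDWalk.nil x hx
  | cons x y z t hx h w ih =>
    rw [add_comm, dist_comm]
    exact ih.trans (UDWalk.edge w.left_mem hx (by rwa [dist_comm]))

lemma udwalk_bdd (x y : α) : BddBelow {t | UDWalk P x y t} :=
  ⟨dist x y, fun _ h => UDWalk.dist_le h⟩

lemma UDWalk.dG_le {x y : α} {t : ℝ} (w : UDWalk P x y t) : dG P x y ≤ t := by
  rw [dG_eq]; exact csInf_le (udwalk_bdd x y) w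

lemma udwalk_exists (hc : UDConnected P) {x y : α} (hx : x ∈ P) (hy : y ∈ P) :
    ∃ t, UDWalk P x y t := by
  obtain ⟨m, f, hf, h0, hl⟩ := hc x hx y hy
  have := udwalk_of_path m f hf
  rw [h0, hl] at this
  exact ⟨_, this⟩

lemma dist_le_dG (hc : UDConnected P) {x y : α} (hx : x ∈ P) (hy : y ∈ P) :
    dist x y ≤ dG P x y := by
  rw [dG_eq]; exact le_csInf (udwalk_exists hc hx hy) (fun _ h => UDWalk.dist_le h)

lemma dG_le_dist {x y : α} (hx : x ∈ P) (hy : y ∈ P) (h : dist x y ≤ 1) :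
    dG P x y ≤ dist x y := (UDWalk.edge hx hy h).dG_le

lemma dG_symm (x y : α) : dG P x y = dG P y x := by
  rw [dG_eq, dG_eq]; congr 1; ext t; exact ⟨UDWalk.symm, UDWalk.symm⟩

lemma dG_triangle (hc : UDConnected P) {x y z : α} (hx : x ∈ P) (hy : y ∈ P) (hz : z ∈ P) :
    dG P x z ≤ dG P x y + dG P y z := by
  have h1 : ∀ s, UDWalk P x y s → dG P x z - s ≤ dG P y z := by
    intro s hs
    rw [dG_eq y z]
    refine le_csInf (udwalk_exists hc hy hz) fun t ht => ?_
    have := (UDWalk.trans hs ht).dG_le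
    linarith
  have h2 : dG P x z - dG P y z ≤ dG P x y := by
    rw [dG_eq x y]
    refine le_csInf (udwalk_exists hc hx hy) fun t ht => ?_
    have := h1 t ht
    linarith
  linarith

lemma UDWalk.ivt (hc : UDConnected P) {v : α} (hv : v ∈ P) {T : ℝ} {x w : α} {s : ℝ}
    (hw : UDWalk P x w s) : dG P v x ≤ T → T ≤ dG P v w →
    ∃ p ∈ P, T ≤ dG P v p ∧ dG P v p ≤ T + 1 := by
  induction hw with
  | nil x hx => intro h1 h2; exact ⟨x, hx, h2, by linarith⟩
  | cons x y z t hx h w ih =>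
    intro h1 h2
    by_cases h3 : dG P v y ≤ T
    · exact ih h3 h2
    · refine ⟨y, w.left_mem, by linarith, ?_⟩
      have := dG_triangle hc hv hx w.left_mem
      have := dG_le_dist hx w.left_mem h
      linarith

end walks

/-- The properties of the graph metric that are used. -/
structure GoodMetric {α : Type*} [MetricSpace α] (P : Set α) (D : α → α → ℝ) : Prop where
  dist_le : ∀ x ∈ P, ∀ y ∈ P, dist x y ≤ D x y
  le_dist : ∀ x ∈ P, ∀ y ∈ P, dist x y ≤ 1 → D x y ≤ dist x y
  symm : ∀ x y, D x y = D y x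
  tri : ∀ x ∈ P, ∀ y ∈ P, ∀ z ∈ P, D x z ≤ D x y + D y z
  ivt : ∀ v ∈ P, ∀ w ∈ P, ∀ T, 0 ≤ T → T ≤ D v w → ∃ p ∈ P, T ≤ D v p ∧ D v p ≤ T + 1

lemma goodMetric_dG {α : Type*} [MetricSpace α] {P : Set α} (hc : UDConnected P) :
    GoodMetric P (dG P) where
  dist_le x hx y hy := dist_le_dG hc hx hy
  le_dist x hx y hy h := dG_le_dist hx hy h
  symm := dG_symm
  tri x hx y hy z hz := dG_triangle hc hx hy hz
  ivt v hv w hw T hT h := by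
    obtain ⟨s, hs⟩ := udwalk_exists hc hv hw
    refine hs.ivt hc hv ?_ h
    have := dG_le_dist hv hv (by simp)
    simp only [dist_self] at this
    linarith

/-- Separated pairs, in a pointwise form. -/
structure SepPair {α : Type*} (P : Set α) (D : α → α → ℝ) (ε : ℝ) (A B : Set α) : Prop where
  sub1 : A ⊆ P
  sub2 : B ⊆ P
  ne1 : A.Nonempty
  ne2 : B.Nonempty
  disj : Disjoint A B
  sep1 : ∀ a ∈ A, ∀ a' ∈ A, ∀ x ∈ A, ∀ y ∈ B, D a a' ≤ ε * D x y
  sep2 : ∀ b ∈ B, ∀ b' ∈ B, ∀ x ∈ A, ∀ y ∈ B, D b b' ≤ ε * D x y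

lemma SepPair.wellSep {α : Type*} [MetricSpace α] {P : Set α} {ε : ℝ} (hε : 0 < ε) {A B : Set α}
    (h : SepPair P (dG P) ε A B) : WellSepG P (1 / ε) A B := by
  obtain ⟨a0, ha0⟩ := h.ne1
  obtain ⟨b0, hb0⟩ := h.ne2
  unfold WellSepG
  rw [one_div_one_div]
  have key : ∀ M : ℝ, (∀ x ∈ A, ∀ y ∈ B, M ≤ ε * dG P x y) → M ≤ ε * dGSetDist P A B := by
    intro M hM
    have : M / ε ≤ dGSetDist P A B := by
      refine le_csInf ⟨_, a0, ha0, b0, hb0, rfl⟩ ?_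
      rintro t ⟨x, hx, y, hy, rfl⟩
      rw [div_le_iff₀ hε, mul_comm]
      exact hM x hx y hy
    rwa [div_le_iff₀ hε, mul_comm] at this
  refine max_le ?_ ?_
  · apply key
    intro x hx y hy
    refine csSup_le ⟨_, a0, ha0, a0, ha0, rfl⟩ ?_
    rintro t ⟨a, ha, a', ha', rfl⟩
    exact h.sep1 a ha a' ha' x hx y hy
  · apply key
    intro x hx y hy
    refine csSup_le ⟨_, b0, hb0, b0, hb0, rfl⟩ ?_
    rintro t ⟨a, ha, a', ha', rfl⟩
    exact h.sep2 a ha a' ha' x hx y hy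

section grid
variable {d : ℕ}

/-- Grid cell index at level `k` (side length `1/(d 2^k)`). -/
noncomputable def gcell (k : ℕ) (x : EuclideanSpace ℝ (Fin d)) : Fin d → ℤ :=
  fun i => ⌊x i * (d * 2 ^ k)⌋

lemma gcell_dist (hd : 0 < d) {k : ℕ} {x y : EuclideanSpace ℝ (Fin d)}
    (h : gcell k x = gcell k y) : dist x y ≤ 1 / 2 ^ k := by
  have hd' : (0 : ℝ) < d := by exact_mod_cast hd
  have hd1 : (1 : ℝ) ≤ d := by exact_mod_cast hd
  have hc : ∀ i, dist (x i) (y i) ^ 2 ≤ (1 / (d * 2 ^ k)) ^ 2 := by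
    intro i
    have h1 := Int.abs_sub_lt_one_of_floor_eq_floor (congrFun h i)
    have h2 : |x i - y i| * (d * 2 ^ k) < 1 := by
      rw [← sub_mul, abs_mul, abs_of_pos (by positivity : (0 : ℝ) < d * 2 ^ k)] at h1
      exact h1
    have h3 : |x i - y i| ≤ 1 / (d * 2 ^ k) := by
      rw [le_div_iff₀ (by positivity)]; exact h2.le
    rw [Real.dist_eq]
    gcongr
  rw [EuclideanSpace.dist_eq]
  apply Real.sqrt_le_iff.mpr
  refine ⟨by positivity, ?_⟩
  calc ∑ i, dist (x i) (y i) ^ 2 ≤ ∑ i : Fin d, (1 / (d * 2 ^ k) : ℝ) ^ 2 :=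
        Finset.sum_le_sum fun i _ => hc i
    _ = (1 / d) * (1 / 2 ^ k) ^ 2 := by simp; field_simp
    _ ≤ 1 * (1 / 2 ^ k) ^ 2 := by
        gcongr
        rw [div_le_iff₀ hd']; linarith
    _ = _ := one_mul _

lemma gcell_coarsen {k : ℕ} {x y : EuclideanSpace ℝ (Fin d)}
    (h : gcell (k + 1) x = gcell (k + 1) y) : gcell k x = gcell k y := by
  have key : ∀ z : EuclideanSpace ℝ (Fin d), ∀ i, gcell k z i = gcell (k + 1) z i / 2 := by
    intro z i
    unfold gcell
    have h1 : z i * (d * 2 ^ k) = z i * (d * 2 ^ (k + 1)) / (2 : ℕ) := by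
      push_cast; ring
    rw [h1, Int.floor_div_natCast]
    rfl
  ext i
  rw [key, key, h]

lemma gcell_coarsen' {j k : ℕ} (hjk : j ≤ k) {x y : EuclideanSpace ℝ (Fin d)}
    (h : gcell k x = gcell k y) : gcell j x = gcell j y := by
  induction hjk with
  | refl => exact h
  | step _ ih => exact ih (gcell_coarsen h)

/-- Box of cell indices meeting a ball. -/
noncomputable def gbox (k : ℕ) (q : EuclideanSpace ℝ (Fin d)) (s : ℝ) : Finset (Fin d → ℤ) :=
  Fintype.piFinset fun i => Finset.Icc ⌊(q i - s) * (d * 2 ^ k)⌋ ⌊(q i + s) * (d * 2 ^ k)⌋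

lemma mem_gbox {k : ℕ} {q x : EuclideanSpace ℝ (Fin d)} {s : ℝ} (h : dist x q ≤ s) :
    gcell k x ∈ gbox k q s := by
  unfold gbox
  rw [Fintype.mem_piFinset]
  intro i
  have h1 : |x i - q i| ≤ s := by
    have := PiLp.norm_apply_le (x - q) i
    rw [← dist_eq_norm] at this
    simp only [PiLp.sub_apply, Real.norm_eq_abs] at this
    linarith
  rw [abs_le] at h1
  rw [Finset.mem_Icc]
  unfold gcell
  constructor
  · apply Int.floor_le_floor
    gcongr
    linarith
  · apply Int.floor_le_floor
    gcongr
    linarith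

lemma card_gbox (k : ℕ) (q : EuclideanSpace ℝ (Fin d)) {s : ℝ} (hs : 0 ≤ s) :
    ((gbox k q s).card : ℝ) ≤ (2 * s * (d * 2 ^ k) + 2) ^ d := by
  unfold gbox
  rw [Fintype.card_piFinset]
  push_cast
  calc _ ≤ ∏ i : Fin d, (2 * s * (d * 2 ^ k) + 2 : ℝ) := by
        apply Finset.prod_le_prod
        · intro i _; positivity
        · intro i _
          rw [Int.card_Icc]
          set u := (q i - s) * (d * 2 ^ k : ℝ) with hu
          set v := (q i + s) * (d * 2 ^ k : ℝ) with hv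
          have huv : u + 2 * s * (d * 2 ^ k) = v := by rw [hu, hv]; ring
          have h0 : 0 ≤ s * (d * 2 ^ k : ℝ) := by positivity
          have h1 := Int.lt_floor_add_one u
          have h2 := Int.floor_le v
          have h4 : ⌊u⌋ ≤ ⌊v⌋ := Int.floor_le_floor (by nlinarith)
          have h3 : (((⌊v⌋ + 1 - ⌊u⌋).toNat : ℕ) : ℝ) = (⌊v⌋ + 1 - ⌊u⌋ : ℝ) := by
            have : (((⌊v⌋ + 1 - ⌊u⌋).toNat : ℕ) : ℤ) = ⌊v⌋ + 1 - ⌊u⌋ := Int.toNat_of_nonneg (by omega)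
            exact_mod_cast this
          rw [h3]
          linarith
    _ = _ := by simp

end grid

section fine
variable {d : ℕ}

/-- Points of `P` in a grid cell. -/
def cset (P : Set (EuclideanSpace ℝ (Fin d))) (k : ℕ) (c : Fin d → ℤ) :
    Set (EuclideanSpace ℝ (Fin d)) := {y | y ∈ P ∧ gcell k y = c}

lemma sep_of_far (hd : 0 < d) {P : Set (EuclideanSpace ℝ (Fin d))}
    {D : EuclideanSpace ℝ (Fin d) → EuclideanSpace ℝ (Fin d) → ℝ} (hD : GoodMetric P D)
    {ε : ℝ} (h0 : 0 < ε) (h1 : ε < 1) {x y : EuclideanSpace ℝ (Fin d)} (hx : x ∈ P) (hy : y ∈ P)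
    {k : ℕ} (h : 3 / 2 ^ k ≤ ε * D x y) :
    SepPair P D ε (cset P k (gcell k x)) (cset P k (gcell k y)) := by
  have hp : (0 : ℝ) < 1 / 2 ^ k := by positivity
  have hle : (1 : ℝ) / 2 ^ k ≤ 1 := by
    rw [div_le_one (by positivity)]; exact one_le_pow₀ (by norm_num)
  have hdiam : ∀ a ∈ P, ∀ b ∈ P, gcell k a = gcell k b → D a b ≤ 1 / 2 ^ k := by
    intro a ha b hb hab
    have := gcell_dist hd hab
    exact (hD.le_dist a ha b hb (this.trans hle)).trans this
  have h3 : (3 : ℝ) / 2 ^ k = 3 * (1 / 2 ^ k) := by ring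
  have hfar : ∀ a ∈ cset P k (gcell k x), ∀ b ∈ cset P k (gcell k y), 1 / 2 ^ k ≤ ε * D a b := by
    rintro a ⟨ha, hac⟩ b ⟨hb, hbc⟩
    have e1 := hdiam x hx a ha hac.symm
    have e2 := hdiam b hb y hy hbc
    have e3 := hD.tri x hx a ha y hy
    have e4 := hD.tri a ha b hb y hy
    have e5 : D x y ≤ D a b + 2 * (1 / 2 ^ k) := by linarith
    nlinarith
  refine ⟨fun z hz => hz.1, fun z hz => hz.1, ⟨x, hx, rfl⟩, ⟨y, hy, rfl⟩, ?_, ?_, ?_⟩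
  · rw [Set.disjoint_left]
    intro z hz1 hz2
    have e1 := hfar z hz1 z hz2
    have e2 := hD.le_dist z hz1.1 z hz1.1 (by simp)
    rw [dist_self] at e2
    nlinarith
  · rintro a ⟨ha, hac⟩ b ⟨hb, hbc⟩ u hu v hv
    exact (hdiam a ha b hb (hac.trans hbc.symm)).trans (hfar u hu v hv)
  · rintro a ⟨ha, hac⟩ b ⟨hb, hbc⟩ u hu v hv
    exact (hdiam a ha b hb (hac.trans hbc.symm)).trans (hfar u hu v hv)

lemma exists_split_level (P : Set (EuclideanSpace ℝ (Fin d))) (hP : P.Finite) :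
    ∃ μ : EuclideanSpace ℝ (Fin d) → ℕ, ∀ x ∈ P, ∀ k,
      cset P (k + 1) (gcell (k + 1) x) ≠ cset P k (gcell k x) →
      ∃ q ∈ P, μ q = k + 1 ∧ gcell k q = gcell k x := by
  obtain ⟨f, hf⟩ := Set.countable_iff_exists_injOn.mp hP.countable
  let isRep : ℕ → EuclideanSpace ℝ (Fin d) → Prop :=
    fun k q => ∀ y ∈ P, gcell k y = gcell k q → f q ≤ f y
  have hmin : ∀ k, ∀ x ∈ P, ∃ q ∈ P, gcell k q = gcell k x ∧ isRep k q := by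
    intro k x hx
    have hfin : (cset P k (gcell k x)).Finite := hP.subset fun z hz => hz.1
    obtain ⟨q, hq, hmin⟩ := Set.exists_min_image _ f hfin ⟨x, hx, rfl⟩
    exact ⟨q, hq.1, hq.2, fun y hy hyq => hmin y ⟨hy, hyq.trans hq.2⟩⟩
  refine ⟨fun q => sInf {k | isRep k q}, ?_⟩
  intro x hx k hne
  have hz : ∃ z ∈ P, gcell k z = gcell k x ∧ gcell (k + 1) z ≠ gcell (k + 1) x := by
    by_contra! hcon
    apply hne
    ext z
    exact ⟨fun h => ⟨h.1, gcell_coarsen h.2⟩, fun h => ⟨h.1, hcon z h.1 h.2⟩⟩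
  obtain ⟨z, hz, hzk, hzk1⟩ := hz
  obtain ⟨r, hr, hrk, hrr⟩ := hmin k x hx
  have hw : ∃ w ∈ P, gcell k w = gcell k x ∧ gcell (k + 1) w ≠ gcell (k + 1) r := by
    by_cases h : gcell (k + 1) x = gcell (k + 1) r
    · exact ⟨z, hz, hzk, by rwa [← h]⟩
    · exact ⟨x, hx, rfl, h⟩
  obtain ⟨w, hw, hwk, hwr⟩ := hw
  obtain ⟨q, hq, hqk, hqr⟩ := hmin (k + 1) w hw
  have hqk' : gcell k q = gcell k x := (gcell_coarsen hqk).trans hwk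
  refine ⟨q, hq, ?_, hqk'⟩
  have hnot : ¬ isRep k q := by
    intro h
    have e1 := h r hr (hrk.trans hqk'.symm)
    have e2 := hrr q hq (hqk'.trans hrk.symm)
    have e3 := hf hq hr (le_antisymm e1 e2)
    rw [e3] at hqk
    exact hwr hqk.symm
  apply le_antisymm
  · exact Nat.sInf_le hqr
  · refine le_csInf ⟨_, hqr⟩ ?_
    intro j hj
    by_contra! hlt
    exact hnot fun y hy hyq => hj y hy (gcell_coarsen' (by omega) hyq)

open Classical in
lemma fine_part (hd : 0 < d) {P : Set (EuclideanSpace ℝ (Fin d))} (hP : P.Finite)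
    {D : EuclideanSpace ℝ (Fin d) → EuclideanSpace ℝ (Fin d) → ℝ} (hD : GoodMetric P D)
    {ε : ℝ} (h0 : 0 < ε) (h1 : ε < 1) :
    ∃ W : Finset (Set (EuclideanSpace ℝ (Fin d)) × Set (EuclideanSpace ℝ (Fin d))),
      (∀ pr ∈ W, SepPair P D ε pr.1 pr.2) ∧
      (∀ x ∈ P, ∀ y ∈ P, x ≠ y → D x y ≤ 72 / ε →
        ∃ pr ∈ W, (x ∈ pr.1 ∧ y ∈ pr.2) ∨ (x ∈ pr.2 ∧ y ∈ pr.1)) ∧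
      (W.card : ℝ) ≤ 2 * P.ncard * ((4 * d + 2) ^ d * (402 * d / ε) ^ d) := by
  obtain ⟨μ, hμ⟩ := exists_split_level P hP
  have hdr : (1 : ℝ) ≤ d := by exact_mod_cast hd
  have hε1 : 1 ≤ 1 / ε := by rw [le_div_iff₀ h0]; linarith
  let F : EuclideanSpace ℝ (Fin d) → ℕ →
      Finset (Set (EuclideanSpace ℝ (Fin d)) × Set (EuclideanSpace ℝ (Fin d))) := fun q k =>
    ((gbox k q (2 / 2 ^ k)) ×ˢ (gbox k q (200 / ε / 2 ^ k))).image
      fun c => (cset P k c.1, cset P k c.2)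
  have hF : ∀ q k, ((F q k).card : ℝ) ≤ (4 * d + 2) ^ d * (402 * d / ε) ^ d := by
    intro q k
    have e1 : (F q k).card ≤ (gbox k q (2 / 2 ^ k)).card * (gbox k q (200 / ε / 2 ^ k)).card := by
      refine Finset.card_image_le.trans ?_
      rw [Finset.card_product]
    have e2 := card_gbox k q (s := 2 / 2 ^ k) (by positivity)
    have e3 := card_gbox k q (s := 200 / ε / 2 ^ k) (by positivity)
    have e4 : 2 * (2 / 2 ^ k) * (d * 2 ^ k) + 2 = (4 * d + 2 : ℝ) := by field_simp; ring
    have e5 : 2 * (200 / ε / 2 ^ k) * (d * 2 ^ k) + 2 ≤ (402 * d / ε : ℝ) := by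
      have : 2 * (200 / ε / 2 ^ k) * (d * 2 ^ k) = (400 * d / ε : ℝ) := by field_simp; ring
      rw [this]
      have : (402 * d / ε : ℝ) = 400 * d / ε + 2 * d * (1 / ε) := by ring
      rw [this]
      nlinarith
    rw [e4] at e2
    calc ((F q k).card : ℝ) ≤ (gbox k q (2 / 2 ^ k)).card * (gbox k q (200 / ε / 2 ^ k)).card := by
          exact_mod_cast e1
      _ ≤ _ := by
          gcongr
          refine e3.trans ?_
          gcongr
  have hmemF : ∀ q k x y, x ∈ P → y ∈ P → dist x q ≤ 2 / 2 ^ k → dist y q ≤ 200 / ε / 2 ^ k →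
      (cset P k (gcell k x), cset P k (gcell k y)) ∈ F q k := by
    intro q k x y hx hy hxq hyq
    refine Finset.mem_image.mpr ⟨(gcell k x, gcell k y), ?_, rfl⟩
    exact Finset.mem_product.mpr ⟨mem_gbox hxq, mem_gbox hyq⟩
  let W0 := hP.toFinset.biUnion fun q => F q (μ q) ∪ F q 0
  refine ⟨W0.filter fun pr => SepPair P D ε pr.1 pr.2, fun pr hpr => (Finset.mem_filter.mp hpr).2,
    ?_, ?_⟩
  · have key : ∀ x ∈ P, ∀ y ∈ P, ∀ k,
        SepPair P D ε (cset P (k + 1) (gcell (k + 1) x)) (cset P (k + 1) (gcell (k + 1) y)) →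
        ε * D x y < 3 / 2 ^ k → cset P (k + 1) (gcell (k + 1) x) ≠ cset P k (gcell k x) →
        ∃ pr ∈ W0.filter fun pr => SepPair P D ε pr.1 pr.2, x ∈ pr.1 ∧ y ∈ pr.2 := by
      intro x hx y hy k hs hlt hne
      obtain ⟨q, hq, hμq, hqk⟩ := hμ x hx k hne
      refine ⟨(cset P (k + 1) (gcell (k + 1) x), cset P (k + 1) (gcell (k + 1) y)),
        Finset.mem_filter.mpr ⟨?_, hs⟩, ⟨hx, rfl⟩, ⟨hy, rfl⟩⟩
      refine Finset.mem_biUnion.mpr ⟨q, hP.mem_toFinset.mpr hq, Finset.mem_union_left _ ?_⟩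
      rw [hμq]
      have e1 : dist x q ≤ 2 / 2 ^ (k + 1) := by
        have := gcell_dist hd hqk.symm
        have e : (2 : ℝ) / 2 ^ (k + 1) = 1 / 2 ^ k := by rw [pow_succ]; field_simp
        rw [e]; exact this
      refine hmemF q (k + 1) x y hx hy e1 ?_
      have e2 := hD.dist_le x hx y hy
      have e3 : D x y ≤ 6 * (1 / ε) * (1 / 2 ^ (k + 1)) := by
        have : 6 * (1 / ε) * (1 / 2 ^ (k + 1)) = (3 / 2 ^ k : ℝ) / ε := by
          rw [pow_succ]; field_simp; norm_num
        rw [this, le_div_iff₀ h0]; linarith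
      have e4 := dist_triangle y x q
      rw [dist_comm y x] at e4
      have e5 : (2 : ℝ) / 2 ^ (k + 1) ≤ 2 * (1 / ε) * (1 / 2 ^ (k + 1)) := by
        have : (2 : ℝ) / 2 ^ (k + 1) = 2 * 1 * (1 / 2 ^ (k + 1)) := by ring
        rw [this]; gcongr
      have e6 : (200 / ε / 2 ^ (k + 1) : ℝ) = 200 * (1 / ε) * (1 / 2 ^ (k + 1)) := by ring
      have e7 : 0 < (1 / ε) * (1 / 2 ^ (k + 1)) := by positivity
      rw [e6]
      nlinarith
    intro x hx y hy hxy hDxy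
    have hpos : 0 < D x y := (dist_pos.mpr hxy).trans_le (hD.dist_le x hx y hy)
    have hex : ∃ k, SepPair P D ε (cset P k (gcell k x)) (cset P k (gcell k y)) := by
      obtain ⟨k, hk⟩ := exists_pow_lt_of_lt_one (show 0 < ε * D x y / 3 by positivity)
        (show (1 / 2 : ℝ) < 1 by norm_num)
      refine ⟨k, sep_of_far hd hD h0 h1 hx hy ?_⟩
      have : (3 : ℝ) / 2 ^ k = 3 * (1 / 2) ^ k := by rw [one_div, inv_pow]; ring
      rw [this]; linarith
    rcases hk : Nat.find hex with _ | k
    · have hs := Nat.find_spec hex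
      rw [hk] at hs
      refine ⟨(cset P 0 (gcell 0 x), cset P 0 (gcell 0 y)),
        Finset.mem_filter.mpr ⟨?_, hs⟩, Or.inl ⟨⟨hx, rfl⟩, ⟨hy, rfl⟩⟩⟩
      refine Finset.mem_biUnion.mpr ⟨x, hP.mem_toFinset.mpr hx, Finset.mem_union_right _ ?_⟩
      refine hmemF x 0 x y hx hy (by simp) ?_
      rw [dist_comm]
      refine ((hD.dist_le x hx y hy).trans hDxy).trans ?_
      rw [pow_zero, div_one]
      gcongr
      norm_num
    · have hs := Nat.find_spec hex
      rw [hk] at hs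
      have hnot : ¬ SepPair P D ε (cset P k (gcell k x)) (cset P k (gcell k y)) :=
        Nat.find_min hex (by omega)
      have hlt : ε * D x y < 3 / 2 ^ k := by
        by_contra! hcon
        exact hnot (sep_of_far hd hD h0 h1 hx hy hcon)
      by_cases hne : cset P (k + 1) (gcell (k + 1) x) = cset P k (gcell k x)
      · have hne' : cset P (k + 1) (gcell (k + 1) y) ≠ cset P k (gcell k y) := by
          intro h
          rw [hne, h] at hs
          exact hnot hs
        have hs' : SepPair P D ε (cset P (k + 1) (gcell (k + 1) y))
            (cset P (k + 1) (gcell (k + 1) x)) :=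
          ⟨hs.sub2, hs.sub1, hs.ne2, hs.ne1, hs.disj.symm,
            fun a ha b hb u hu v hv => by rw [hD.symm u v]; exact hs.sep2 a ha b hb v hv u hu,
            fun a ha b hb u hu v hv => by rw [hD.symm u v]; exact hs.sep1 a ha b hb v hv u hu⟩
        obtain ⟨pr, hpr, h⟩ := key y hy x hx k hs' (by rwa [hD.symm]) hne'
        exact ⟨pr, hpr, Or.inr ⟨h.2, h.1⟩⟩
      · obtain ⟨pr, hpr, h⟩ := key x hx y hy k hs hlt hne
        exact ⟨pr, hpr, Or.inl h⟩
  · have e1 : (W0.card : ℝ) ≤ ∑ q ∈ hP.toFinset, (2 * ((4 * d + 2) ^ d * (402 * d / ε) ^ d) : ℝ) := by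
      have : W0.card ≤ ∑ q ∈ hP.toFinset, (F q (μ q) ∪ F q 0).card := Finset.card_biUnion_le
      calc (W0.card : ℝ) ≤ ∑ q ∈ hP.toFinset, ((F q (μ q) ∪ F q 0).card : ℝ) := by exact_mod_cast this
        _ ≤ _ := by
          refine Finset.sum_le_sum fun q _ => ?_
          have : ((F q (μ q) ∪ F q 0).card : ℝ) ≤ (F q (μ q)).card + (F q 0).card := by
            exact_mod_cast Finset.card_union_le _ _
          linarith [hF q (μ q), hF q 0]
    have e2 : ((W0.filter fun pr => SepPair P D ε pr.1 pr.2).card : ℝ) ≤ W0.card := by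
      exact_mod_cast Finset.card_filter_le _ _
    rw [Finset.sum_const, nsmul_eq_mul, ← Set.ncard_eq_toFinset_card P hP] at e1
    refine (e2.trans e1).trans (le_of_eq (by ring))

end fine

section coarse
variable {d : ℕ}

open Classical in
lemma exists_net {α : Type*} (P : Finset α) (D : α → α → ℝ) (hs : ∀ x y, D x y = D y x) (ρ : ℝ) :
    ∃ N ⊆ P, (∀ u ∈ N, ∀ v ∈ N, u ≠ v → ρ < D u v) ∧ ∀ x ∈ P, x ∉ N → ∃ v ∈ N, D x v ≤ ρ := by
  let Q : Finset α → Prop := fun N => ∀ u ∈ N, ∀ v ∈ N, u ≠ v → ρ < D u v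
  let S := P.powerset.filter Q
  have hS : S.Nonempty := ⟨∅, by simp [S, Q]⟩
  obtain ⟨N, hN, hmax⟩ := Finset.exists_max_image S Finset.card hS
  have hN' := Finset.mem_filter.mp hN
  have hNP := Finset.mem_powerset.mp hN'.1
  refine ⟨N, hNP, hN'.2, ?_⟩
  intro x hx hxN
  by_contra! hcon
  have hmem : insert x N ∈ S := by
    refine Finset.mem_filter.mpr ⟨Finset.mem_powerset.mpr (Finset.insert_subset hx hNP), ?_⟩
    intro u hu v hv huv
    rcases Finset.mem_insert.mp hu with hu' | hu'
    · rcases Finset.mem_insert.mp hv with hv' | hv'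
      · exact absurd (hu'.trans hv'.symm) huv
      · rw [hu']; exact hcon v hv'
    · rcases Finset.mem_insert.mp hv with hv' | hv'
      · rw [hs, hv']; exact hcon u hu'
      · exact hN'.2 u hu' v hv' huv
  have := hmax _ hmem
  rw [Finset.card_insert_of_notMem hxN] at this
  omega

open Classical in
lemma coarse_part (hd : 0 < d) {P : Set (EuclideanSpace ℝ (Fin d))} (hP : P.Finite)
    {D : EuclideanSpace ℝ (Fin d) → EuclideanSpace ℝ (Fin d) → ℝ} (hD : GoodMetric P D)
    {ε : ℝ} (h0 : 0 < ε) (h1 : ε < 1) (L : ℕ) (hL : 1 ≤ L) :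
    ∃ W : Finset (Set (EuclideanSpace ℝ (Fin d)) × Set (EuclideanSpace ℝ (Fin d))),
      (∀ pr ∈ W, SepPair P D ε pr.1 pr.2) ∧
      (∀ x ∈ P, ∀ y ∈ P, 72 * L / ε < D x y → D x y ≤ 2 * (72 * L / ε) →
        ∃ pr ∈ W, (x ∈ pr.1 ∧ y ∈ pr.2) ∨ (x ∈ pr.2 ∧ y ∈ pr.1)) ∧
      (W.card : ℝ) ≤ (P.ncard / L) * (P.ncard / L) ∧
      (W.card : ℝ) ≤ (P.ncard / L) * ((720 * d * L / ε) ^ d / L) := by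
  set r : ℝ := 72 * L / ε with hr
  have hdr : (1 : ℝ) ≤ d := by exact_mod_cast hd
  have hLr : (1 : ℝ) ≤ L := by exact_mod_cast hL
  have hεr : ε * r = 72 * L := by rw [hr]; field_simp
  have hr72 : 72 * L ≤ r := by
    rw [hr, le_div_iff₀ h0]; nlinarith
  have hself : ∀ x ∈ P, D x x = 0 := by
    intro x hx
    have e1 := hD.le_dist x hx x hx (by simp)
    have e2 := hD.dist_le x hx x hx
    simp only [dist_self] at e1 e2
    linarith
  have hnn : ∀ x ∈ P, ∀ y ∈ P, 0 ≤ D x y := fun x hx y hy =>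
    dist_nonneg.trans (hD.dist_le x hx y hy)
  obtain ⟨N, hNP, hsep, hcov⟩ := exists_net hP.toFinset D hD.symm (9 * L)
  have hNP' : ∀ v ∈ N, v ∈ P := fun v hv => hP.mem_toFinset.mp (hNP hv)
  have hcov' : ∀ x ∈ P, ∃ v ∈ N, D x v ≤ 9 * L := by
    intro x hx
    by_cases h : x ∈ N
    · exact ⟨x, h, by rw [hself x hx]; positivity⟩
    · exact hcov x (hP.mem_toFinset.mpr hx) h
  choose! π hπN hπ using hcov'
  let K : EuclideanSpace ℝ (Fin d) → Set (EuclideanSpace ℝ (Fin d)) := fun v => {x | x ∈ P ∧ π x = v}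
  let T : Finset (EuclideanSpace ℝ (Fin d) × EuclideanSpace ℝ (Fin d)) :=
    (N ×ˢ N).filter fun p => p.1 ≠ p.2 ∧ D p.1 p.2 ≤ 3 * r
  let W0 := (T.image fun p => (K p.1, K p.2)).filter fun pr => SepPair P D ε pr.1 pr.2
  have hW0 : W0.card ≤ T.card := (Finset.card_filter_le _ _).trans Finset.card_image_le
  have hKdiam : ∀ a ∈ P, ∀ b ∈ P, π a = π b → D a b ≤ 18 * L := by
    intro a ha b hb hab
    have e1 := hπ a ha
    have e2 := hπ b hb
    have hm := hNP' _ (hπN a ha)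
    rw [← hab] at e2
    have e3 := hD.tri a ha (π a) hm b hb
    rw [hD.symm (π a) b] at e3
    linarith
  refine ⟨W0, fun pr hpr => (Finset.mem_filter.mp hpr).2, ?_, ?_⟩
  · intro x hx y hy hlo hhi
    have hfar : ∀ a ∈ K (π x), ∀ b ∈ K (π y), 18 * L ≤ ε * D a b := by
      rintro a ⟨ha, hax⟩ b ⟨hb, hby⟩
      have e1 := hKdiam x hx a ha hax.symm
      have e2 := hKdiam b hb y hy hby
      have e3 := hD.tri x hx a ha y hy
      have e4 := hD.tri a ha b hb y hy
      have e5 : r - 36 * L ≤ D a b := by linarith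
      have e6 : ε * (r - 36 * L) ≤ ε * D a b := by gcongr
      nlinarith
    have hs : SepPair P D ε (K (π x)) (K (π y)) := by
      refine ⟨fun z hz => hz.1, fun z hz => hz.1, ⟨x, hx, rfl⟩, ⟨y, hy, rfl⟩, ?_, ?_, ?_⟩
      · rw [Set.disjoint_left]
        intro z hz1 hz2
        have e1 := hfar z hz1 z hz2
        rw [hself z hz1.1] at e1
        linarith
      · rintro a ⟨ha, hac⟩ b ⟨hb, hbc⟩ u hu v hv
        exact (hKdiam a ha b hb (hac.trans hbc.symm)).trans (hfar u hu v hv)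
      · rintro a ⟨ha, hac⟩ b ⟨hb, hbc⟩ u hu v hv
        exact (hKdiam a ha b hb (hac.trans hbc.symm)).trans (hfar u hu v hv)
    refine ⟨(K (π x), K (π y)), Finset.mem_filter.mpr ⟨Finset.mem_image.mpr
      ⟨(π x, π y), Finset.mem_filter.mpr ⟨Finset.mem_product.mpr ⟨hπN x hx, hπN y hy⟩, ?_, ?_⟩, rfl⟩,
      hs⟩, Or.inl ⟨⟨hx, rfl⟩, ⟨hy, rfl⟩⟩⟩
    · intro hxy
      have := hKdiam x hx y hy hxy
      linarith
    · have hm1 := hNP' _ (hπN x hx)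
      have hm2 := hNP' _ (hπN y hy)
      have e1 := hD.tri (π x) hm1 x hx (π y) hm2
      have e2 := hD.tri x hx y hy (π y) hm2
      rw [hD.symm (π x) x] at e1
      have e3 := hπ x hx
      have e4 := hπ y hy
      simp only
      linarith
  · -- counting
    by_cases hT : T = ∅
    · have : W0.card = 0 := by rw [hT] at hW0; simpa using hW0
      rw [this]
      push_cast
      constructor <;> positivity
    have hother : ∀ v ∈ N, ∃ w ∈ P, 9 * L < D v w := by
      intro v hv
      obtain ⟨⟨a, b⟩, hab⟩ := Finset.nonempty_iff_ne_empty.mpr hT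
      obtain ⟨hab1, hab2, -⟩ := Finset.mem_filter.mp hab
      obtain ⟨ha, hb⟩ := Finset.mem_product.mp hab1
      simp only at hab2 ha hb
      by_cases hva : v = a
      · exact ⟨b, hNP' b hb, hsep v hv b hb (by rwa [hva])⟩
      · exact ⟨a, hNP' a ha, hsep v hv a ha hva⟩
    have hp : ∀ v ∈ N, ∀ m ∈ Finset.range L, ∃ p ∈ P, (3 * m : ℝ) ≤ D v p ∧ D v p ≤ 3 * m + 1 := by
      intro v hv m hm
      obtain ⟨w, hw, hvw⟩ := hother v hv
      have : (m : ℝ) < L := by exact_mod_cast Finset.mem_range.mp hm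
      exact hD.ivt v (hNP' v hv) w hw (3 * m) (by positivity) (by linarith)
    choose! p hpP hplo hphi using hp
    have hm3 : ∀ m ∈ Finset.range L, (m : ℝ) + 1 ≤ L := by
      intro m hm; exact_mod_cast Finset.mem_range.mp hm
    have hinj : ∀ v ∈ N, ∀ m ∈ Finset.range L, ∀ v' ∈ N, ∀ m' ∈ Finset.range L,
        gcell 0 (p v m) = gcell 0 (p v' m') → v = v' ∧ m = m' := by
      intro v hv m hm v' hv' m' hm' hc
      have e0 := gcell_dist hd hc
      rw [pow_zero, div_one] at e0
      have e1 := (hD.le_dist _ (hpP v hv m hm) _ (hpP v' hv' m' hm') e0).trans e0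
      have e2 := hplo v hv m hm
      have e3 := hphi v hv m hm
      have e4 := hplo v' hv' m' hm'
      have e5 := hphi v' hv' m' hm'
      have e6 := hm3 m hm
      have e7 := hm3 m' hm'
      have hvv : v = v' := by
        by_contra hne
        have f1 := hsep v hv v' hv' hne
        have f2 := hD.tri v (hNP' v hv) _ (hpP v hv m hm) v' (hNP' v' hv')
        have f3 := hD.tri _ (hpP v hv m hm) _ (hpP v' hv' m' hm') v' (hNP' v' hv')
        rw [hD.symm (p v' m') v'] at f3
        linarith
      subst hvv
      refine ⟨rfl, ?_⟩
      have f1 := hD.tri v (hNP' v hv) _ (hpP v hv m hm) _ (hpP v hv m' hm')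
      have f2 := hD.tri v (hNP' v hv) _ (hpP v hv m' hm') _ (hpP v hv m hm)
      rw [hD.symm (p v m') (p v m)] at f2
      have g1 : (m : ℝ) < m' + 1 := by linarith
      have g2 : (m' : ℝ) < m + 1 := by linarith
      have g1' : m < m' + 1 := by exact_mod_cast g1
      have g2' : m' < m + 1 := by exact_mod_cast g2
      omega
    have hNcard : (N.card : ℝ) ≤ P.ncard / L := by
      rw [le_div_iff₀ (by linarith)]
      have : (N ×ˢ Finset.range L).card ≤ hP.toFinset.card := by
        refine Finset.card_le_card_of_injOn (fun z => p z.1 z.2) ?_ ?_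
        · rintro ⟨v, m⟩ hz
          obtain ⟨hv, hm⟩ := Finset.mem_product.mp hz
          simpa using hpP v hv m hm
        · rintro ⟨v, m⟩ hz ⟨v', m'⟩ hz' heq
          obtain ⟨hv, hm⟩ := Finset.mem_product.mp hz
          obtain ⟨hv', hm'⟩ := Finset.mem_product.mp hz'
          simp only at heq
          obtain ⟨a, b⟩ := hinj v hv m hm v' hv' m' hm' (by rw [heq])
          rw [a, b]
      rw [Finset.card_product, Finset.card_range, ← Set.ncard_eq_toFinset_card P hP] at this
      exact_mod_cast this
    have hnb : ∀ u ∈ N, ((N.filter fun v => D u v ≤ 3 * r).card : ℝ) ≤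
        (720 * d * L / ε) ^ d / L := by
      intro u hu
      rw [le_div_iff₀ (by linarith)]
      have e1 : ((N.filter fun v => D u v ≤ 3 * r) ×ˢ Finset.range L).card ≤
          (gbox 0 u (4 * r)).card := by
        refine Finset.card_le_card_of_injOn (fun z => gcell 0 (p z.1 z.2)) ?_ ?_
        · rintro ⟨v, m⟩ hz
          obtain ⟨hv, hm⟩ := Finset.mem_product.mp hz
          obtain ⟨hv, hv2⟩ := Finset.mem_filter.mp hv
          refine mem_gbox ?_
          simp only at hv hm hv2 ⊢
          rw [dist_comm]
          have f1 := hD.dist_le u (hNP' u hu) _ (hpP v hv m hm)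
          have f2 := hD.tri u (hNP' u hu) v (hNP' v hv) _ (hpP v hv m hm)
          have f3 := hphi v hv m hm
          have f4 := hm3 m hm
          linarith
        · rintro ⟨v, m⟩ hz ⟨v', m'⟩ hz' heq
          obtain ⟨hv, hm⟩ := Finset.mem_product.mp hz
          obtain ⟨hv', hm'⟩ := Finset.mem_product.mp hz'
          obtain ⟨a, b⟩ := hinj v (Finset.mem_filter.mp hv).1 m hm v' (Finset.mem_filter.mp hv').1
            m' hm' heq
          rw [a, b]
      rw [Finset.card_product, Finset.card_range] at e1
      have e2 := card_gbox 0 u (s := 4 * r) (by linarith)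
      have e3 : (2 * (4 * r) * (d * 2 ^ 0) + 2 : ℝ) ≤ 720 * d * L / ε := by
        have : (720 * d * L / ε : ℝ) = 10 * r * d := by rw [hr]; ring
        rw [this]
        nlinarith
      calc ((N.filter fun v => D u v ≤ 3 * r).card : ℝ) * L ≤ (gbox 0 u (4 * r)).card := by
            exact_mod_cast e1
        _ ≤ _ := e2
        _ ≤ _ := by gcongr
    have hW0r : (W0.card : ℝ) ≤ T.card := by exact_mod_cast hW0
    constructor
    · have : (T.card : ℝ) ≤ N.card * N.card := by
        have : T.card ≤ (N ×ˢ N).card := Finset.card_filter_le _ _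
        rw [Finset.card_product] at this
        exact_mod_cast this
      refine (hW0r.trans this).trans ?_
      gcongr
    · have hsub : T ⊆ N.biUnion fun u => (N.filter fun v => D u v ≤ 3 * r).image fun v => (u, v) := by
        rintro ⟨u, v⟩ h
        obtain ⟨hp1, hp2, hp3⟩ := Finset.mem_filter.mp h
        obtain ⟨hu, hv⟩ := Finset.mem_product.mp hp1
        exact Finset.mem_biUnion.mpr ⟨u, hu, Finset.mem_image.mpr
          ⟨v, Finset.mem_filter.mpr ⟨hv, hp3⟩, rfl⟩⟩
      have e1 : T.card ≤ ∑ u ∈ N, (N.filter fun v => D u v ≤ 3 * r).card :=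
        (Finset.card_le_card hsub).trans (Finset.card_biUnion_le.trans
          (Finset.sum_le_sum fun u _ => Finset.card_image_le))
      have e2 : (T.card : ℝ) ≤ ∑ u ∈ N, ((N.filter fun v => D u v ≤ 3 * r).card : ℝ) := by
        exact_mod_cast e1
      have e3 := e2.trans (Finset.sum_le_sum hnb)
      rw [Finset.sum_const, nsmul_eq_mul] at e3
      refine (hW0r.trans e3).trans ?_
      gcongr

end coarse

lemma sum_min_le {X : ℝ} (hX : 1 ≤ X) (J : ℕ) :
    ∑ j ∈ Finset.range J, min (X / 2 ^ j) (2 ^ j / X) ≤ 4 := by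
  have h1 : ∀ J : ℕ, ∑ j ∈ Finset.range J, min (X / 2 ^ j) (2 ^ j / X) ≤ 2 ^ J / X := by
    intro J
    induction J with
    | zero => simp; linarith
    | succ J ih =>
      rw [Finset.sum_range_succ]
      have := min_le_right (X / 2 ^ J) (2 ^ J / X)
      have e : (2 : ℝ) ^ (J + 1) / X = 2 ^ J / X + 2 ^ J / X := by rw [pow_succ]; ring
      linarith
  have h2 : ∀ J : ℕ, X < 2 ^ J →
      ∑ j ∈ Finset.range J, min (X / 2 ^ j) (2 ^ j / X) ≤ 4 - 2 * (X / 2 ^ J) := by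
    intro J
    induction J with
    | zero => intro h; simp at h; linarith
    | succ J ih =>
      intro h
      have e : X / 2 ^ J = 2 * (X / 2 ^ (J + 1)) := by rw [pow_succ]; field_simp
      by_cases hJ : X < 2 ^ J
      · rw [Finset.sum_range_succ]
        have := min_le_left (X / 2 ^ J) (2 ^ J / X)
        have := ih hJ
        linarith
      · push Not at hJ
        have e1 := h1 (J + 1)
        have e2 : (2 : ℝ) ^ (J + 1) / X ≤ 2 := by
          rw [div_le_iff₀ (by linarith), pow_succ]; linarith
        have e3 : X / 2 ^ (J + 1) ≤ 1 := by
          rw [div_le_one (by positivity)]; exact h.le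
        linarith
  by_cases hJ : X < 2 ^ J
  · have := h2 J hJ
    have : 0 ≤ X / 2 ^ J := by positivity
    linarith
  · push Not at hJ
    have := h1 J
    have : (2 : ℝ) ^ J / X ≤ 1 := by rw [div_le_one (by linarith)]; exact hJ
    linarith

open Classical in
lemma main_bound {d : ℕ} (hd : 3 ≤ d) {P : Set (EuclideanSpace ℝ (Fin d))} (hP : P.Finite)
    {D : EuclideanSpace ℝ (Fin d) → EuclideanSpace ℝ (Fin d) → ℝ} (hD : GoodMetric P D)
    {ε : ℝ} (h0 : 0 < ε) (h1 : ε < 1) {X : ℝ} (hX0 : 0 < X) (hXd : X ^ d = P.ncard * ε ^ d)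
    (hn : 2 ≤ P.ncard) :
    ∃ W : Finset (Set (EuclideanSpace ℝ (Fin d)) × Set (EuclideanSpace ℝ (Fin d))),
      (∀ pr ∈ W, SepPair P D ε pr.1 pr.2) ∧
      (∀ x ∈ P, ∀ y ∈ P, x ≠ y →
        ∃ pr ∈ W, (x ∈ pr.1 ∧ y ∈ pr.2) ∨ (x ∈ pr.2 ∧ y ∈ pr.1)) ∧
      (W.card : ℝ) ≤ (1 + 2 * ((4 * d + 2) ^ d * (402 * d) ^ d) + 4 * (720 * d) ^ d) *
        ((P.ncard : ℝ) ^ 2 / X ^ 2) := by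
  set n : ℝ := (P.ncard : ℝ) with hnr
  have hn0 : 0 < n := by rw [hnr]; exact_mod_cast (by omega : 0 < P.ncard)
  set B := n ^ 2 / X ^ 2 with hB
  have hB0 : 0 < B := by positivity
  have hd0 : 0 < d := by omega
  have hdr : (1 : ℝ) ≤ d := by exact_mod_cast hd0
  set C1 : ℝ := 2 * ((4 * d + 2) ^ d * (402 * d) ^ d) with hC1
  set C2 : ℝ := (720 * d) ^ d with hC2
  have hC10 : 0 < C1 := by positivity
  have hC20 : 1 ≤ C2 := one_le_pow₀ (by linarith)
  by_cases hX : X < 1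
  · let W0 := ((hP.toFinset ×ˢ hP.toFinset).image fun z => (({z.1}, {z.2}) :
      Set (EuclideanSpace ℝ (Fin d)) × Set (EuclideanSpace ℝ (Fin d))))
    refine ⟨W0.filter fun pr => SepPair P D ε pr.1 pr.2, fun pr hpr => (Finset.mem_filter.mp hpr).2,
      ?_, ?_⟩
    · intro x hx y hy hxy
      have hz : ∀ x ∈ P, D x x ≤ 0 := fun x hx => by
        simpa using hD.le_dist x hx x hx (by simp)
      have hpos : 0 ≤ ε * D x y :=
        mul_nonneg h0.le (dist_nonneg.trans (hD.dist_le x hx y hy))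
      refine ⟨({x}, {y}), Finset.mem_filter.mpr ⟨Finset.mem_image.mpr ⟨(x, y), by simp [hx, hy], rfl⟩,
        ?_⟩, Or.inl ⟨rfl, rfl⟩⟩
      refine ⟨by simpa using hx, by simpa using hy, by simp, by simp, by simpa using hxy, ?_, ?_⟩
      · rintro a rfl b rfl u rfl v rfl
        exact (hz _ hx).trans hpos
      · rintro a rfl b rfl u rfl v rfl
        exact (hz _ hy).trans hpos
    · have e1 : (W0.filter fun pr => SepPair P D ε pr.1 pr.2).card ≤ P.ncard * P.ncard := by
        refine ((Finset.card_filter_le _ _).trans Finset.card_image_le).trans ?_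
        rw [Finset.card_product, ← Set.ncard_eq_toFinset_card P hP]
      have e2 : ((W0.filter fun pr => SepPair P D ε pr.1 pr.2).card : ℝ) ≤ n * n := by
        rw [hnr]; exact_mod_cast e1
      have e3 : n * n ≤ B := by
        rw [hB, le_div_iff₀ (by positivity)]
        have : X ^ 2 ≤ 1 := pow_le_one₀ hX0.le hX.le
        nlinarith [mul_pos hn0 hn0]
      have e4 : 0 ≤ (C1 + 4 * C2) * B := by positivity
      nlinarith
  push Not at hX
  have hne : n / ε ^ d = n ^ 2 / X ^ d := by
    rw [hXd]; field_simp
  obtain ⟨Wf, hWf1, hWf2, hWf3⟩ := fine_part hd0 hP hD h0 h1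
  choose Wc hWc1 hWc2 hWc3 hWc4 using fun j : ℕ =>
    coarse_part hd0 hP hD h0 h1 (2 ^ j) (Nat.one_le_two_pow)
  obtain ⟨M, hM⟩ : ∃ M : ℝ, ∀ x ∈ P, ∀ y ∈ P, D x y ≤ M := by
    obtain ⟨M, hM⟩ := ((hP.prod hP).image fun z => D z.1 z.2).bddAbove
    exact ⟨M, fun x hx y hy => hM ⟨(x, y), ⟨hx, hy⟩, rfl⟩⟩
  obtain ⟨J, hJ⟩ := pow_unbounded_of_one_lt (M * ε / 72) (show (1 : ℝ) < 2 by norm_num)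
  refine ⟨Wf ∪ (Finset.range J).biUnion Wc, ?_, ?_, ?_⟩
  · intro pr hpr
    rcases Finset.mem_union.mp hpr with h | h
    · exact hWf1 pr h
    · obtain ⟨j, -, hj⟩ := Finset.mem_biUnion.mp h
      exact hWc1 j pr hj
  · intro x hx y hy hxy
    have hex : ∃ j : ℕ, D x y ≤ 72 * 2 ^ j / ε := by
      refine ⟨J, ?_⟩
      rw [le_div_iff₀ h0]
      have := hM x hx y hy
      nlinarith
    rcases hj : Nat.find hex with _ | j
    · have hs := Nat.find_spec hex
      rw [hj, pow_zero, mul_one] at hs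
      obtain ⟨pr, hpr, h⟩ := hWf2 x hx y hy hxy hs
      exact ⟨pr, Finset.mem_union_left _ hpr, h⟩
    · have hs := Nat.find_spec hex
      rw [hj] at hs
      have hnot := Nat.find_min hex (show j < Nat.find hex by omega)
      push Not at hnot
      have hjJ : j < J := by
        have : Nat.find hex ≤ J := Nat.find_min' hex (by
          rw [le_div_iff₀ h0]
          have := hM x hx y hy
          nlinarith)
        omega
      obtain ⟨pr, hpr, h⟩ := hWc2 j x hx y hy (by push_cast; exact hnot) (by
        push_cast
        refine hs.trans (le_of_eq ?_)
        rw [pow_succ]; ring)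
      exact ⟨pr, Finset.mem_union_right _ (Finset.mem_biUnion.mpr
        ⟨j, Finset.mem_range.mpr hjJ, hpr⟩), h⟩
  · have f1 : (Wf.card : ℝ) ≤ C1 * B := by
      refine hWf3.trans ?_
      have e1 : 2 * n * ((4 * d + 2) ^ d * (402 * d / ε) ^ d) = C1 * (n / ε ^ d) := by
        rw [hC1, div_pow]; ring
      rw [← hnr, e1, hne, hB]
      gcongr
      omega
    have f2 : ∀ j, ((Wc j).card : ℝ) ≤ C2 * B * min (X / 2 ^ j) (2 ^ j / X) := by
      intro j
      have g3 := hWc3 j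
      have g4 := hWc4 j
      rw [← hnr] at g3 g4
      push_cast at g3 g4
      set L : ℝ := 2 ^ j with hL
      have hL0 : 0 < L := by positivity
      rcases le_total L X with hLX | hLX
      · have e1 : L / X ≤ X / L := by
          rw [div_le_div_iff₀ hX0 hL0]; nlinarith
        rw [min_eq_right e1]
        refine g4.trans ?_
        obtain ⟨m, rfl⟩ : ∃ m, d = m + 3 := ⟨d - 3, by omega⟩
        have e2 : n / L * ((720 * ((m + 3 : ℕ) : ℝ) * L / ε) ^ (m + 3) / L) =
            C2 * (n / ε ^ (m + 3)) * L ^ (m + 1) := by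
          rw [hC2, div_pow, mul_pow _ L]; field_simp; ring
        rw [e2, hne, hB]
        have e3 : C2 * (n ^ 2 / X ^ (m + 3)) * L ^ (m + 1) =
            C2 * (n ^ 2 / X ^ 2) * ((L / X) ^ m * (L / X)) := by
          rw [div_pow]; field_simp; ring
        rw [e3]
        have e4 : (L / X) ^ m ≤ 1 := pow_le_one₀ (by positivity) ((div_le_one hX0).mpr hLX)
        gcongr
        exact mul_le_of_le_one_left (by positivity) e4
      · have e1 : X / L ≤ L / X := by
          rw [div_le_div_iff₀ hL0 hX0]; nlinarith
        rw [min_eq_left e1]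
        refine g3.trans ?_
        have e2 : n / L * (n / L) = 1 * B * ((X / L) * (X / L)) := by
          rw [hB]; field_simp
        rw [e2]
        have e4 : X / L ≤ 1 := (div_le_one hL0).mpr hLX
        gcongr
        exact mul_le_of_le_one_left (by positivity) e4
    have f3 : (((Finset.range J).biUnion Wc).card : ℝ) ≤ C2 * B * 4 := by
      have e1 : (((Finset.range J).biUnion Wc).card : ℝ) ≤
          ∑ j ∈ Finset.range J, ((Wc j).card : ℝ) := by
        exact_mod_cast Finset.card_biUnion_le
      refine e1.trans ((Finset.sum_le_sum fun j _ => f2 j).trans ?_)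
      rw [← Finset.mul_sum]
      have := sum_min_le hX J
      gcongr
    have f4 : ((Wf ∪ (Finset.range J).biUnion Wc).card : ℝ) ≤
        Wf.card + ((Finset.range J).biUnion Wc).card := by
      exact_mod_cast Finset.card_union_le _ _
    nlinarith

/-- **WSPD for weighted unit-distance graphs in higher dimensions.** For every
`d ≥ 3` there is a constant `c_d > 0` such that every connected weighted unit-distance
graph on `n ≥ 2` points in `ℝ^d` admits, for every `ε ∈ (0,1)`, a `(1/ε)`-WSPD with
respect to the shortest-path metric of size at most `c_d·n^{2−2/d}/ε²`. -/
theorem wspd_unit_distance_higher_dim :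
    ∀ d : ℕ, 3 ≤ d →
    ∃ c : ℝ, 0 < c ∧
      ∀ ε : ℝ, 0 < ε → ε < 1 →
      ∀ P : Set (EuclideanSpace ℝ (Fin d)), P.Finite → 2 ≤ P.ncard → UDConnected P →
        ∃ W : Finset (Set (EuclideanSpace ℝ (Fin d)) × Set (EuclideanSpace ℝ (Fin d))),
          IsWSPDG P (1 / ε) W ∧
          (W.card : ℝ) ≤ c * (P.ncard : ℝ) ^ ((2 : ℝ) - 2 / (d : ℝ)) / ε ^ 2 := by
  intro d hd
  have hd0 : (0 : ℝ) < d := by exact_mod_cast (by omega : 0 < d)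
  refine ⟨1 + 2 * ((4 * d + 2) ^ d * (402 * d) ^ d) + 4 * (720 * d) ^ d, by positivity, ?_⟩
  intro ε h0 h1 P hP hn hc
  have hn0 : (0 : ℝ) < P.ncard := by exact_mod_cast (by omega : 0 < P.ncard)
  have hX : (((P.ncard : ℝ) ^ (1 / (d : ℝ))) * ε) ^ d = P.ncard * ε ^ d := by
    rw [mul_pow, ← Real.rpow_natCast ((P.ncard : ℝ) ^ (1 / (d : ℝ))), ← Real.rpow_mul hn0.le,
      one_div_mul_cancel hd0.ne', Real.rpow_one]
  obtain ⟨W, hW1, hW2, hW3⟩ := main_bound hd hP (goodMetric_dG hc) h0 h1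
    (X := ((P.ncard : ℝ) ^ (1 / (d : ℝ))) * ε) (by positivity) hX hn
  refine ⟨W, ⟨fun pr hpr => ?_, hW2⟩, ?_⟩
  · have h := hW1 pr hpr
    exact ⟨h.sub1, h.sub2, h.ne1, h.ne2, h.disj, h.wellSep h0⟩
  · refine hW3.trans (le_of_eq ?_)
    have e : (P.ncard : ℝ) ^ 2 / (((P.ncard : ℝ) ^ (1 / (d : ℝ))) * ε) ^ 2 =
        (P.ncard : ℝ) ^ ((2 : ℝ) - 2 / (d : ℝ)) / ε ^ 2 := by
      rw [mul_pow, ← Real.rpow_natCast ((P.ncard : ℝ) ^ (1 / (d : ℝ))), ← Real.rpow_mul hn0.le,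
        Real.rpow_sub hn0, div_mul_eq_div_div]
      congr 2
      · norm_num
      · congr 1; push_cast; ring
    rw [e]; ring
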